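/- arXiv:2101.00700 — 4 statements merged into one kernel-verified Lean document; each statement's English description precedes it below -/
import Mathlib

section
/- Let {E_1,…,E_k} be a COSI set of complex n×n matrices, and let f : {1,…,k}×{1,…,k} → {1,…,k} be a Latin square, i.e. for each fixed i the map j ↦ f(i,j) is a bijection and for each fixed j the map i ↦ f(i,j) is a bijection. Define the kn×kn block matrix G whose (i,j) block is E_{f(i,j)}. Then G·Gᴴ = I_{kn}, i.e. G is a unitary matrix. -/
open Matrix

/-- A COSI set arranged in a Latin-square block pattern gives a unitary matrix. -/
theorem cosi_latin_square_unitary (n k : ℕ)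
    (E : Fin k → Matrix (Fin n) (Fin n) ℂ)
    (hherm : ∀ i, (E i)ᴴ = E i)
    (hidem : ∀ i, E i * E i = E i)
    (horth : ∀ i j, i ≠ j → E i * E j = 0)
    (hsum : ∑ i, E i = 1)
    (f : Fin k → Fin k → Fin k)
    (hrow : ∀ i, Function.Bijective (fun j => f i j))
    (hcol : ∀ j, Function.Bijective (fun i => f i j))
    (G : Matrix (Fin k × Fin n) (Fin k × Fin n) ℂ)
    (hG : ∀ p q, G p q = E (f p.1 q.1) p.2 q.2) :
    G * Gᴴ = 1 := by
  ext ⟨i, a⟩ ⟨i', b⟩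
  have key : (G * Gᴴ) (i, a) (i', b) = (∑ j, E (f i j) * E (f i' j)) a b := by
    rw [Matrix.mul_apply, Fintype.sum_prod_type, Matrix.sum_apply]
    refine Finset.sum_congr rfl fun j _ => ?_
    rw [Matrix.mul_apply]
    refine Finset.sum_congr rfl fun c _ => ?_
    rw [Matrix.conjTranspose_apply, hG, hG]
    congr 1
    have h := congrFun (congrFun (hherm (f i' j)) c) b
    rw [Matrix.conjTranspose_apply] at h
    exact h
  rw [key]
  by_cases h : i = i'
  · subst h
    have h2 : ∑ j, E (f i j) * E (f i j) = 1 := by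
      rw [← hsum]
      simp only [hidem]
      exact (hrow i).sum_comp E
    rw [h2]
    simp [Matrix.one_apply]
  · have h2 : ∑ j, E (f i j) * E (f i' j) = 0 :=
      Finset.sum_eq_zero fun j _ => horth _ _ fun e => h ((hcol j).1 e)
    rw [h2]
    simp [Matrix.one_apply, h]
end

section
/- Let {E_1,…,E_k} be a COSI set of complex n×n matrices, let f : {1,…,k}×{1,…,k} → {1,…,k} be a Latin square (each index appears exactly once in each row and once in each column), and let α_{ij} (1 ≤ i,j ≤ k) be arbitrary nonzero complex numbers. Let G be the kn×kn block matrix whose (i,j) block is α_{ij}·E_{f(i,j)}, and let H be the kn×kn block matrix whose (j,i) block is α_{ij}^{-1}·E_{f(i,j)}ᴴ. Then G·H = I_{kn}. (This is the paraunitary identity G(α)·G*(α^{-1}) = I evaluated at any nonzero values of the variables α_{ij}.) -/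
open Matrix

/-- The paraunitary identity G(α)·G*(α⁻¹) = I for a Latin-square block arrangement
of a COSI set with nonzero complex values attached. -/
theorem cosi_latin_square_paraunitary (n k : ℕ)
    (E : Fin k → Matrix (Fin n) (Fin n) ℂ)
    (hherm : ∀ i, (E i)ᴴ = E i)
    (hidem : ∀ i, E i * E i = E i)
    (horth : ∀ i j, i ≠ j → E i * E j = 0)
    (hsum : ∑ i, E i = 1)
    (f : Fin k → Fin k → Fin k)
    (hrow : ∀ i, Function.Bijective (fun j => f i j))
    (hcol : ∀ j, Function.Bijective (fun i => f i j))
    (α : Fin k → Fin k → ℂ)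
    (hα : ∀ i j, α i j ≠ 0)
    (G : Matrix (Fin k × Fin n) (Fin k × Fin n) ℂ)
    (hG : ∀ p q, G p q = α p.1 q.1 * E (f p.1 q.1) p.2 q.2)
    (H : Matrix (Fin k × Fin n) (Fin k × Fin n) ℂ)
    (hH : ∀ p q, H p q = (α q.1 p.1)⁻¹ * (E (f q.1 p.1))ᴴ p.2 q.2) :
    G * H = 1 := by
  ext ⟨i, a⟩ ⟨l, b⟩
  have key : (G * H) (i, a) (l, b)
      = ∑ j, α i j * (α l j)⁻¹ * (E (f i j) * E (f l j)) a b := by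
    rw [Matrix.mul_apply, Fintype.sum_prod_type]
    refine Finset.sum_congr rfl fun j _ => ?_
    rw [Matrix.mul_apply, Finset.mul_sum]
    refine Finset.sum_congr rfl fun c _ => ?_
    rw [hG, hH, hherm]
    ring
  rw [key]
  by_cases h : i = l
  · subst h
    have h1 : ∀ j, α i j * (α i j)⁻¹ * (E (f i j) * E (f i j)) a b = E (f i j) a b := by
      intro j
      rw [mul_inv_cancel₀ (hα i j), one_mul, hidem]
    rw [Finset.sum_congr rfl fun j _ => h1 j,
      (hrow i).sum_comp (fun m => E m a b), ← Matrix.sum_apply, hsum]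
    simp [Matrix.one_apply]
  · rw [Finset.sum_eq_zero]
    · simp [Matrix.one_apply, h]
    · intro j _
      rw [horth _ _ fun e => h ((hcol j).1 e)]
      simp
end

section
/- Let R be a commutative ring, let U = (u_{ij}) be a k×k matrix over R, and let A_1,…,A_k be n×n matrices over R. Let T = (U;A_1,…,A_k) be the left matrix tangle product, i.e. the kn×kn block matrix whose (i,j) block is u_{ij}·A_j. Then det T = det(A_1)·det(A_2)⋯det(A_k)·(det U)^n. -/
open Matrix

/-- Determinant of the left matrix tangle product:
det (U; A₁, …, A_k) = det A₁ ⋯ det A_k · (det U)^n. -/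
theorem det_left_tangle_product (R : Type*) [CommRing R] (k n : ℕ)
    (U : Matrix (Fin k) (Fin k) R)
    (A : Fin k → Matrix (Fin n) (Fin n) R)
    (T : Matrix (Fin k × Fin n) (Fin k × Fin n) R)
    (hT : ∀ p q, T p q = U p.1 q.1 * A q.1 p.2 q.2) :
    T.det = (∏ j, (A j).det) * U.det ^ n := by
  have h : T = (kroneckerMap (· * ·) U (1 : Matrix (Fin n) (Fin n) R)) *
      (blockDiagonal A).submatrix (Equiv.prodComm _ _) (Equiv.prodComm _ _) := by
    ext ⟨a, b⟩ ⟨c, d⟩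
    rw [hT, Matrix.mul_apply, Fintype.sum_prod_type]
    simp [blockDiagonal_apply, Matrix.one_apply]
  rw [h, det_mul, det_kronecker, det_submatrix_equiv_self, det_blockDiagonal]
  simp [mul_comm]
end

section
/- Let R be a commutative ring equipped with a star-ring structure, and for a matrix M over R let Mᴴ denote its star-transpose (transpose with the star applied entrywise). Let A_1,…,A_k be m×m matrices over R with A_j·A_jᴴ = I_m for every j, and let U = (u_{ij}) be a k×k matrix over R with U·Uᴴ = I_k. Then both the left matrix tangle product (U;A_1,…,A_k), whose (i,j) block is u_{ij}·A_j, and the right matrix tangle product (A_1,…,A_k;U), whose (i,j) block is u_{ij}·A_i, satisfy T·Tᴴ = I_{km}. (Applied to rings of Laurent polynomials with the paraunitary star, this says that the matrix tangle product of paraunitary matrices is paraunitary.) -/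
open Matrix

/-- Over a commutative star-ring, both the left and right matrix tangle products of
matrices satisfying M·Mᴴ = I (e.g. paraunitary matrices over Laurent polynomial
rings) again satisfy T·Tᴴ = I. -/
theorem tangle_product_star_unitary (R : Type*) [CommRing R] [StarRing R] (m k : ℕ)
    (A : Fin k → Matrix (Fin m) (Fin m) R)
    (hA : ∀ j, A j * (A j)ᴴ = 1)
    (U : Matrix (Fin k) (Fin k) R)
    (hU : U * Uᴴ = 1)
    (L : Matrix (Fin k × Fin m) (Fin k × Fin m) R)
    (hL : ∀ p q, L p q = U p.1 q.1 * A q.1 p.2 q.2)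
    (Rt : Matrix (Fin k × Fin m) (Fin k × Fin m) R)
    (hR : ∀ p q, Rt p q = U p.1 q.1 * A p.1 p.2 q.2) :
    L * Lᴴ = 1 ∧ Rt * Rtᴴ = 1 := by
  have hA' : ∀ j a a', ∑ b, A j a b * star (A j a' b) = if a = a' then 1 else 0 := by
    intro j a a'
    have h := congrFun (congrFun (hA j) a) a'
    simpa [Matrix.mul_apply, Matrix.one_apply] using h
  have hU' : ∀ i i', ∑ j, U i j * star (U i' j) = if i = i' then 1 else 0 := by
    intro i i'
    have h := congrFun (congrFun hU i) i'
    simpa [Matrix.mul_apply, Matrix.one_apply] using h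
  constructor
  · ext ⟨i, a⟩ ⟨i', a'⟩
    have h1 : (L * Lᴴ) (i, a) (i', a') =
        ∑ j, (U i j * star (U i' j)) * ∑ b, A j a b * star (A j a' b) := by
      simp only [Matrix.mul_apply, Matrix.conjTranspose_apply, hL, Fintype.sum_prod_type,
        Finset.mul_sum, star_mul]
      refine Finset.sum_congr rfl fun j _ => Finset.sum_congr rfl fun b _ => ?_
      ring
    rw [h1]
    simp only [hA']
    rw [← Finset.sum_mul, hU', Matrix.one_apply]
    by_cases h : i = i' <;> by_cases h' : a = a' <;> simp [h, h']
  · ext ⟨i, a⟩ ⟨i', a'⟩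
    have h1 : (Rt * Rtᴴ) (i, a) (i', a') =
        (∑ j, U i j * star (U i' j)) * ∑ b, A i a b * star (A i' a' b) := by
      simp only [Matrix.mul_apply, Matrix.conjTranspose_apply, hR, Fintype.sum_prod_type,
        Finset.sum_mul_sum, star_mul]
      refine Finset.sum_congr rfl fun j _ => Finset.sum_congr rfl fun b _ => ?_
      ring
    rw [h1, hU', Matrix.one_apply]
    by_cases h : i = i'
    · subst h
      rw [hA']
      by_cases h' : a = a' <;> simp [h']
    · simp [h]
end
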